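/- Let E be a real inner product space, let θ ∈ E, let L₂ : E → ℝ be differentiable at θ with gradient ∇L₂(θ), let P be a finite nonempty set, and let g : P → E. Then there exists η₀ > 0 such that for every learning rate η with 0 < η < η₀, every minimizer of the outer loss after a one-step update is a maximizer of the gradient inner product: if p ∈ P satisfies L₂(θ − η·g(p)) ≤ L₂(θ − η·g(q)) for all q ∈ P, then ⟨g(p), ∇L₂(θ)⟩ ≥ ⟨g(q), ∇L₂(θ)⟩ for all q ∈ P. -/

import Mathlib

open scoped RealInnerProductSpace

/-- The outer loss along the descent ray in direction `v` has derivative `-⟪v, ∇L⟫` at `0`. -/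
lemma HasGradientAt.hasDerivAt_sub_smul
    {E : Type*} [NormedAddCommGroup E] [InnerProductSpace ℝ E] [CompleteSpace E]
    {θ : E} {L : E → ℝ} {gradL : E} (hL : HasGradientAt L gradL θ) (v : E) :
    HasDerivAt (fun η : ℝ => L (θ - η • v)) (-⟪v, gradL⟫) 0 := by
  have hline : HasDerivAt (fun η : ℝ => θ - η • v) (-v) 0 := by
    simpa using ((hasDerivAt_id (0 : ℝ)).smul_const v).const_sub θ
  have hL' : HasFDerivAt L (InnerProductSpace.toDual ℝ E gradL) (θ - (0 : ℝ) • v) := by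
    simpa using hL.hasFDerivAt
  simpa [Function.comp_def, real_inner_comm] using hL'.comp_hasDerivAt (0 : ℝ) hline

/-- A direction with larger gradient inner product gives a strictly smaller loss after a
sufficiently short step. -/
lemma HasGradientAt.eventually_sub_smul_lt
    {E : Type*} [NormedAddCommGroup E] [InnerProductSpace ℝ E] [CompleteSpace E]
    {θ : E} {L : E → ℝ} {gradL : E} (hL : HasGradientAt L gradL θ) {v w : E}
    (hvw : ⟪v, gradL⟫ < ⟪w, gradL⟫) :
    ∀ᶠ η : ℝ in nhdsWithin 0 (Set.Ioi 0), L (θ - η • w) < L (θ - η • v) := by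
  have hd := (hL.hasDerivAt_sub_smul v).sub (hL.hasDerivAt_sub_smul w)
  have hslope := hd.tendsto_slope_zero_right.eventually
    (lt_mem_nhds (a := (0 : ℝ)) (by linarith))
  filter_upwards [hslope, self_mem_nhdsWithin] with η hη hpos
  have hdiff := (pos_iff_pos_of_mul_pos hη).1 (inv_pos.2 hpos)
  simpa using hdiff

/-- For all sufficiently small learning rates `η > 0`, every minimizer of the outer loss
after a one-step update is a maximizer of the gradient inner product. -/
theorem one_step_minimizer_maximizes_inner
    {E : Type*} [NormedAddCommGroup E] [InnerProductSpace ℝ E] [CompleteSpace E]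
    (θ : E) (L₂ : E → ℝ) (gradL : E) (hL : HasGradientAt L₂ gradL θ)
    {P : Type*} [Fintype P] [Nonempty P] (g : P → E) :
    ∃ η₀ > (0 : ℝ), ∀ η : ℝ, 0 < η → η < η₀ → ∀ p : P,
      (∀ q : P, L₂ (θ - η • g p) ≤ L₂ (θ - η • g q)) →
      ∀ q : P, ⟪g q, gradL⟫ ≤ ⟪g p, gradL⟫ := by
  have hev : ∀ᶠ η : ℝ in nhdsWithin 0 (Set.Ioi 0), ∀ p q : P,
      ⟪g p, gradL⟫ < ⟪g q, gradL⟫ → L₂ (θ - η • g q) < L₂ (θ - η • g p) := by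
    simp only [Filter.eventually_all]
    exact fun _ _ h => hL.eventually_sub_smul_lt h
  obtain ⟨η₀, hη₀, hsub⟩ := mem_nhdsGT_iff_exists_Ioo_subset.1 hev
  refine ⟨η₀, hη₀, fun η hpos hlt p hmin q => ?_⟩
  by_contra! h
  exact (hsub ⟨hpos, hlt⟩ p q h).not_ge (hmin q)
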